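/- Let X be a centered d-dimensional Gaussian random vector with non-singular correlation matrix \Sigma and let b = c_{-1} = (c_2,...,c_d) have at least one positive component. Let \mathcal{I} and \mathcal{L} be the index sets corresponding to the quadratic programming problem \Pi_B(b), where B is the covariance matrix of X_{-1}, and suppose \mathcal{I} = {k,...,d-1}. Set I = {k+1,...,d} (indices in X) and c_1 = \Sigma_{1,I}(\Sigma_{II})^{-1} c_I. Then S(c,u) - c_1 u \to E[Y] as u \to \infty, where Y is the distributional limit of (X_1 - c_1 u) conditional on X_{-1} > c_{-1} u. -/

import Mathlib

open MeasureTheory ProbabilityTheory Filter Matrix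
open scoped Topology ENNReal

noncomputable section

/-- Submatrix of `A` keeping rows with indices in `I` and columns with indices in `J`. -/
def subM {ι : Type*} (A : Matrix ι ι ℝ) (I J : Finset ι) : Matrix ↥I ↥J ℝ :=
  fun i j => A i j

/-- Subvector of `c` keeping the entries with indices in `I`. -/
def subV {ι : Type*} (c : ι → ℝ) (I : Finset ι) : ↥I → ℝ := fun i => c i

/-- Density of a centered Gaussian vector with covariance matrix `S`. -/
def gaussPDF {ι : Type*} [Fintype ι] [DecidableEq ι] (S : Matrix ι ι ℝ) (x : ι → ℝ) : ℝ :=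
  (Real.sqrt ((2 * Real.pi) ^ Fintype.card ι * S.det))⁻¹ *
    Real.exp (-(x ⬝ᵥ S⁻¹.mulVec x) / 2)

/-- `X` is, under `P`, a centered Gaussian random vector with covariance matrix `S`. -/
def IsCenteredGaussianRV {Ω ι : Type*} [MeasurableSpace Ω] [Fintype ι] [DecidableEq ι]
    (P : Measure Ω) (X : Ω → ι → ℝ) (S : Matrix ι ι ℝ) : Prop :=
  Measure.map X P =
    (volume : Measure (ι → ℝ)).withDensity fun x => ENNReal.ofReal (gaussPDF S x)

/-- `bt` is a solution of the quadratic programming problem `Π_A(c)`: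
minimise `x ⬝ Σ⁻¹ x` under `x ≥ c`. -/
def IsQPSol {ι : Type*} [Fintype ι] [DecidableEq ι] (A : Matrix ι ι ℝ) (c bt : ι → ℝ) : Prop :=
  (∀ i, c i ≤ bt i) ∧
    ∀ x : ι → ℝ, (∀ i, c i ≤ x i) → bt ⬝ᵥ A⁻¹.mulVec bt ≤ x ⬝ᵥ A⁻¹.mulVec x

/-- `I` is the index set determined by the quadratic programming problem `Π_A(c)`
with solution `bt`. -/
def IsQPIndex {ι : Type*} [Fintype ι] [DecidableEq ι] (A : Matrix ι ι ℝ)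
    (c bt : ι → ℝ) (I : Finset ι) : Prop :=
  I.Nonempty ∧ (∀ i ∈ I, bt i = c i) ∧
    (∀ i : ↥I, 0 < (subM A I I)⁻¹.mulVec (subV c I) i) ∧
    ∀ j : ι, j ∉ I → bt j = (fun i : ↥I => A j i) ⬝ᵥ (subM A I I)⁻¹.mulVec (subV c I)

/-- `Σ_{i₀,I} (Σ_{II})⁻¹ c_I`. -/
def rowDot {ι : Type*} [Fintype ι] [DecidableEq ι] (A : Matrix ι ι ℝ) (c : ι → ℝ)
    (I : Finset ι) (i0 : ι) : ℝ :=
  (fun i : ↥I => A i0 i) ⬝ᵥ (subM A I I)⁻¹.mulVec (subV c I)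

/-- `c_I ⬝ (Σ_{II})⁻¹ e_{i₀}`. -/
def eDot {ι : Type*} [Fintype ι] [DecidableEq ι] (A : Matrix ι ι ℝ) (c : ι → ℝ)
    (I : Finset ι) (i0 : ι) : ℝ :=
  subV c I ⬝ᵥ (subM A I I)⁻¹.mulVec fun j : ↥I => if (j : ι) = i0 then 1 else 0

/-- Schur complement `Σ_{I^cI^c} - Σ_{I^cI}(Σ_{II})⁻¹Σ_{II^c}`, the covariance matrix of the
conditional Gaussian distribution of `X_{I^c}` given `X_I`. -/
def schurC {ι : Type*} [Fintype ι] [DecidableEq ι] (A : Matrix ι ι ℝ) (I : Finset ι) :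
    Matrix ↥Iᶜ ↥Iᶜ ℝ :=
  subM A Iᶜ Iᶜ - subM A Iᶜ I * (subM A I I)⁻¹ * subM A I Iᶜ

/-- The conditional law of `X_{I^c}` given `X_I = 0`. -/
def condNu {ι : Type*} [Fintype ι] [DecidableEq ι] (A : Matrix ι ι ℝ) (I : Finset ι) :
    Measure (↥Iᶜ → ℝ) :=
  (volume : Measure (↥Iᶜ → ℝ)).withDensity fun y => ENNReal.ofReal (gaussPDF (schurC A I) y)

/-- Survival function `Ḡ(x) = P(X_{i₀} > x, X_{N*} > 0 | X_I = 0) / P(X_{N*} > 0 | X_I = 0)`. -/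
def Gbar {ι : Type*} [Fintype ι] [DecidableEq ι] (A : Matrix ι ι ℝ) (I Nstar : Finset ι)
    (i0 : ι) (x : ℝ) : ℝ :=
  (condNu A I {y : ↥Iᶜ → ℝ | (∀ j : ↥Iᶜ, (j : ι) = i0 → x < y j) ∧
      ∀ j : ↥Iᶜ, (j : ι) ∈ Nstar → 0 < y j}).toReal /
    (condNu A I {y : ↥Iᶜ → ℝ | ∀ j : ↥Iᶜ, (j : ι) ∈ Nstar → 0 < y j}).toReal

/-- `E[(Y - μ)₊]` where `Y` has survival function `Gbar A I Nstar i0`. -/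
def condPlusMean {ι : Type*} [Fintype ι] [DecidableEq ι] (A : Matrix ι ι ℝ)
    (I Nstar : Finset ι) (i0 : ι) (μ : ℝ) : ℝ :=
  (∫ y in {y : ↥Iᶜ → ℝ | ∀ j : ↥Iᶜ, (j : ι) ∈ Nstar → 0 < y j},
      max ((∑ j : ↥Iᶜ, if (j : ι) = i0 then y j else 0) - μ) 0 ∂(condNu A I)) /
    (condNu A I {y : ↥Iᶜ → ℝ | ∀ j : ↥Iᶜ, (j : ι) ∈ Nstar → 0 < y j}).toReal

/-- `E[Y]` where `Y` has survival function `Gbar A I Nstar i0`. -/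
def condMean {ι : Type*} [Fintype ι] [DecidableEq ι] (A : Matrix ι ι ℝ)
    (I Nstar : Finset ι) (i0 : ι) : ℝ :=
  (∫ y in {y : ↥Iᶜ → ℝ | ∀ j : ↥Iᶜ, (j : ι) ∈ Nstar → 0 < y j},
      (∑ j : ↥Iᶜ, if (j : ι) = i0 then y j else 0) ∂(condNu A I)) /
    (condNu A I {y : ↥Iᶜ → ℝ | ∀ j : ↥Iᶜ, (j : ι) ∈ Nstar → 0 < y j}).toReal

/-- The conditioning event `{X_2 > c_2 u, ..., X_d > c_d u}`. -/
def tailEvent {Ω : Type*} {d : ℕ} [NeZero d] (X : Ω → Fin d → ℝ) (c : Fin d → ℝ) (u : ℝ) :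
    Set Ω := {ω | ∀ i : Fin d, i ≠ 0 → c i * u < X ω i}

/-- The marginal mean excess `E(c,u) = E[(X_1 - c_1 u - μ)₊ | X_2 > c_2 u, ..., X_d > c_d u]`. -/
def mmeV {Ω : Type*} [MeasurableSpace Ω] {d : ℕ} [NeZero d] (P : Measure Ω)
    (X : Ω → Fin d → ℝ) (c : Fin d → ℝ) (μ u : ℝ) : ℝ :=
  (∫ ω in tailEvent X c u, max (X ω 0 - c 0 * u - μ) 0 ∂P) / (P (tailEvent X c u)).toReal

/-- The marginal expected shortfall `S(c,u) = E[X_1 | X_2 > c_2 u, ..., X_d > c_d u]`. -/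
def mesV {Ω : Type*} [MeasurableSpace Ω] {d : ℕ} [NeZero d] (P : Measure Ω)
    (X : Ω → Fin d → ℝ) (c : Fin d → ℝ) (u : ℝ) : ℝ :=
  (∫ ω in tailEvent X c u, X ω 0 ∂P) / (P (tailEvent X c u)).toReal

/-- The multivariate conditional tail expectation `M(c,u) = E[X_1 | X > c u]`. -/
def mcteV {Ω : Type*} [MeasurableSpace Ω] {d : ℕ} [NeZero d] (P : Measure Ω)
    (X : Ω → Fin d → ℝ) (c : Fin d → ℝ) (u : ℝ) : ℝ :=
  (∫ ω in {ω | ∀ i, c i * u < X ω i}, X ω 0 ∂P) / (P {ω | ∀ i, c i * u < X ω i}).toReal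

/-- The index set `{2,...,d}` of the components of `X_{-1}`. -/
def offFirst (d : ℕ) [NeZero d] : Finset (Fin d) := Finset.univ.filter fun i => i ≠ 0

def scl {ι : Type*} [DecidableEq ι] (I : Finset ι) (s : ℝ) (y : ι → ℝ) : ι → ℝ :=
  fun i => if i ∈ I then s * y i else y i

def EvS {ι : Type*} (I : Finset ι) (i0 : ι) (a : ι → ℝ) : Set (ι → ℝ) :=
  {y | (∀ i ∈ I, 0 < y i) ∧ ∀ j, j ∉ I → j ≠ i0 → a j < y j}

def EvL {ι : Type*} (I Ns : Finset ι) : Set (ι → ℝ) :=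
  {y | (∀ i ∈ I, 0 < y i) ∧ ∀ j ∈ Ns, 0 < y j}

lemma measurableSet_EvS {ι : Type*} [Fintype ι] (I : Finset ι) (i0 : ι) (a : ι → ℝ) :
    MeasurableSet (EvS I i0 a) := by
  unfold EvS
  simp only [measurableSet_setOfPred]
  fun_prop

lemma isOpen_EvL {ι : Type*} [Fintype ι] (I Ns : Finset ι) :
    IsOpen (EvL I Ns) := by
  have : EvL I Ns = (⋂ i ∈ I, {y : ι → ℝ | 0 < y i}) ∩ ⋂ i ∈ Ns, {y : ι → ℝ | 0 < y i} := by
    ext y; simp [EvL]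
  rw [this]
  refine IsOpen.inter ?_ ?_ <;>
  exact isOpen_biInter_finset fun i _ => isOpen_lt continuous_const (continuous_apply i)

lemma quad_cont {ι : Type*} [Fintype ι] (M : Matrix ι ι ℝ) :
    Continuous fun y : ι → ℝ => y ⬝ᵥ M.mulVec y := by
  fun_prop

lemma quad_lower {ι : Type*} [Fintype ι] (M : Matrix ι ι ℝ) (hM : M.PosDef) :
    ∃ lam : ℝ, 0 < lam ∧ ∀ y : ι → ℝ, lam * ∑ i, y i ^ 2 ≤ y ⬝ᵥ M.mulVec y := by
  rcases isEmpty_or_nonempty ι with h | h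
  · exact ⟨1, one_pos, fun y => by simp [dotProduct]⟩
  have hc : IsCompact (Metric.sphere (0 : ι → ℝ) 1) := isCompact_sphere _ _
  have hne : (Metric.sphere (0 : ι → ℝ) 1).Nonempty := NormedSpace.sphere_nonempty.2 zero_le_one
  obtain ⟨x0, hx0, hmin⟩ := hc.exists_isMinOn hne (quad_cont M).continuousOn
  have hx0' : x0 ≠ 0 := by
    rintro rfl
    simp at hx0
  have hpos : 0 < x0 ⬝ᵥ M.mulVec x0 := by simpa using hM.dotProduct_mulVec_pos hx0'
  set m := x0 ⬝ᵥ M.mulVec x0 with hm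
  have hcard : (0:ℝ) < Fintype.card ι := by exact_mod_cast Fintype.card_pos
  refine ⟨m / Fintype.card ι, by positivity, fun y => ?_⟩
  have h1 : ∑ i, y i ^ 2 ≤ Fintype.card ι * ‖y‖ ^ 2 := by
    calc ∑ i, y i ^ 2 ≤ ∑ _i : ι, ‖y‖ ^ 2 := by
          refine Finset.sum_le_sum fun i _ => ?_
          have := norm_le_pi_norm y i
          rw [Real.norm_eq_abs] at this
          rw [← sq_abs]
          gcongr
      _ = _ := by simp
  have h2 : m * ‖y‖ ^ 2 ≤ y ⬝ᵥ M.mulVec y := by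
    by_cases hy : y = 0
    · simp [hy]
    have hyn : ‖y‖ ≠ 0 := norm_ne_zero_iff.2 hy
    have hs : ‖y‖⁻¹ • y ∈ Metric.sphere (0 : ι → ℝ) 1 := by
      simp [norm_smul, hyn]
    have := hmin hs
    simp only [Set.mem_ofPred_eq, mulVec_smul, dotProduct_smul, smul_dotProduct, smul_eq_mul] at this
    rw [← hm] at this
    calc m * ‖y‖ ^ 2 ≤ (‖y‖⁻¹ * (‖y‖⁻¹ * (y ⬝ᵥ M.mulVec y))) * ‖y‖ ^ 2 := by gcongr
      _ = _ := by field_simp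
  calc m / Fintype.card ι * ∑ i, y i ^ 2 ≤ m / Fintype.card ι * (Fintype.card ι * ‖y‖ ^ 2) := by
        gcongr
    _ = m * ‖y‖ ^ 2 := by field_simp
    _ ≤ _ := h2

/-- one-dimensional dominating function -/
def domF {ι : Type*} [DecidableEq ι] (I : Finset ι) (v : ι → ℝ) (lam : ℝ) (i : ι) (t : ℝ) : ℝ :=
  if i ∈ I then (Set.Ioi (0:ℝ)).indicator (fun t => Real.exp (-(v i) * t)) t
  else (1 + |t|) * Real.exp (-lam * t ^ 2)

lemma domF_nonneg {ι : Type*} [DecidableEq ι] (I : Finset ι) (v : ι → ℝ) (lam : ℝ) (i : ι) (t : ℝ) :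
    0 ≤ domF I v lam i t := by
  unfold domF
  split_ifs
  · exact Set.indicator_nonneg (fun _ _ => (Real.exp_pos _).le) _
  · positivity

lemma domF_int {ι : Type*} [DecidableEq ι] (I : Finset ι) (v : ι → ℝ) (hv : ∀ i ∈ I, 0 < v i)
    (lam : ℝ) (hl : 0 < lam) (i : ι) : Integrable (domF I v lam i) := by
  by_cases hi : i ∈ I
  · have : domF I v lam i = (Set.Ioi (0:ℝ)).indicator (fun t => Real.exp (-(v i) * t)) := by
      ext t; simp [domF, hi]
    rw [this, integrable_indicator_iff measurableSet_Ioi]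
    exact exp_neg_integrableOn_Ioi 0 (hv i hi)
  · have : domF I v lam i = fun t => Real.exp (-lam * t ^ 2) + |t * Real.exp (-lam * t ^ 2)| := by
      ext t; simp [domF, hi, abs_mul, add_mul]
    rw [this]
    exact (integrable_exp_neg_mul_sq hl).add (integrable_mul_exp_neg_mul_sq hl).abs

lemma dom_int {ι : Type*} [Fintype ι] [DecidableEq ι] (I : Finset ι) (v : ι → ℝ)
    (hv : ∀ i ∈ I, 0 < v i) (lam : ℝ) (hl : 0 < lam) :
    Integrable fun y : ι → ℝ => ∏ i, domF I v lam i (y i) :=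
  Integrable.fintype_prod fun i => domF_int I v hv lam hl i

lemma dom_bound {ι : Type*} [Fintype ι] [DecidableEq ι] (M : Matrix ι ι ℝ) (I : Finset ι)
    (i0 : ι) (hi0 : i0 ∉ I) (v : ι → ℝ) (hv0 : ∀ i, i ∉ I → v i = 0) (lam : ℝ) (hl : 0 < lam)
    (hlow : ∀ y : ι → ℝ, lam * ∑ i, y i ^ 2 ≤ y ⬝ᵥ M.mulVec y) (g : ℝ → ℝ)
    (hg : ∀ t, |g t| ≤ 1 + |t|) (s : ℝ) (y : ι → ℝ) (hy : ∀ i ∈ I, 0 < y i) :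
    |g (y i0) * Real.exp (-(v ⬝ᵥ y) - (scl I s y ⬝ᵥ M.mulVec (scl I s y)) / 2)| ≤
      ∏ i, domF I v (lam / 2) i (y i) := by
  have e1 : Real.exp (-(v ⬝ᵥ y) - (scl I s y ⬝ᵥ M.mulVec (scl I s y)) / 2) ≤
      ∏ i, (if i ∈ I then Real.exp (-(v i) * y i) else Real.exp (-(lam/2) * y i ^ 2)) := by
    have : ∏ i, (if i ∈ I then Real.exp (-(v i) * y i) else Real.exp (-(lam/2) * y i ^ 2)) =
      Real.exp (∑ i, (if i ∈ I then (-(v i) * y i) else (-(lam/2) * y i ^ 2))) := by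
      rw [Real.exp_sum]
      refine Finset.prod_congr rfl fun i _ => ?_
      split_ifs <;> rfl
    rw [this]
    apply Real.exp_le_exp.2
    have h1 := hlow (scl I s y)
    have h2 : ∑ i, (if i ∈ I then (-(v i) * y i) else (-(lam/2) * y i ^ 2)) ≥
        ∑ i, (-(v i * y i) - lam / 2 * (scl I s y i) ^ 2) := by
      refine Finset.sum_le_sum fun i _ => ?_
      by_cases hi : i ∈ I
      · simp only [hi, if_true]
        have : 0 ≤ lam / 2 * (scl I s y i) ^ 2 := by positivity
        linarith
      · simp [hi, hv0 i hi, scl]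
    rw [Finset.sum_sub_distrib, Finset.sum_neg_distrib, ← Finset.mul_sum] at h2
    simp only [dotProduct] at h1 h2 ⊢
    linarith
  rw [abs_mul, abs_of_pos (Real.exp_pos _)]
  calc _ ≤ (1 + |y i0|) * ∏ i, (if i ∈ I then Real.exp (-(v i) * y i) else Real.exp (-(lam/2) * y i ^ 2)) := by
        gcongr
        exact hg _
    _ ≤ _ := by
        rw [← Finset.mul_prod_erase _ _ (Finset.mem_univ i0), ← Finset.mul_prod_erase _ (fun i => domF I v (lam / 2) i (y i)) (Finset.mem_univ i0), ← mul_assoc]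
        refine mul_le_mul ?_ (Finset.prod_le_prod ?_ ?_) (Finset.prod_nonneg ?_) (domF_nonneg _ _ _ _ _)
        · simp [domF, hi0]
        · intro i _; split_ifs <;> positivity
        · intro i _
          by_cases hi : i ∈ I
          · simp [domF, hi, hy i hi]
          · simp only [domF, hi, if_false]
            have : 0 ≤ |y i| := abs_nonneg _
            nlinarith [Real.exp_pos (-(lam/2) * y i ^ 2)]
        · intro i _; split_ifs <;> positivity

lemma scl_cont {ι : Type*} [DecidableEq ι] (I : Finset ι) (s : ℝ) : Continuous (scl I s) := by
  unfold scl
  refine continuous_pi fun i => ?_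
  split_ifs <;> fun_prop

lemma main_tendsto {ι : Type*} [Fintype ι] [DecidableEq ι] (M : Matrix ι ι ℝ) (hM : M.PosDef)
    (I Ns : Finset ι)
    (i0 : ι) (hi0 : i0 ∉ I) (v : ι → ℝ) (hv : ∀ i ∈ I, 0 < v i) (hv0 : ∀ i, i ∉ I → v i = 0)
    (a : ι → ℝ) (ha : ∀ j, j ∉ I → j ≠ i0 → a j ≤ 0)
    (hNs : ∀ j, j ∈ Ns ↔ j ∉ I ∧ j ≠ i0 ∧ a j = 0) (g : ℝ → ℝ) (hgm : Measurable g)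
    (hg : ∀ t, |g t| ≤ 1 + |t|) :
    Tendsto (fun u : ℝ => ∫ y, (EvS I i0 (fun j => a j * u)).indicator (fun y => g (y i0) *
      Real.exp (-(v ⬝ᵥ y) - (scl I u⁻¹ y ⬝ᵥ M.mulVec (scl I u⁻¹ y)) / 2)) y) atTop
      (𝓝 (∫ y, (EvL I Ns).indicator (fun y => g (y i0) *
      Real.exp (-(v ⬝ᵥ y) - (scl I 0 y ⬝ᵥ M.mulVec (scl I 0 y)) / 2)) y)) := by
  obtain ⟨lam, hl, hlow⟩ := quad_lower M hM
  refine tendsto_integral_filter_of_dominated_convergence (fun y => ∏ i, domF I v (lam / 2) i (y i))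
    (Eventually.of_forall fun u => ?_) (Eventually.of_forall fun u => Eventually.of_forall fun y => ?_)
    (dom_int I v hv _ (by positivity)) (Eventually.of_forall fun y => ?_)
  · refine Measurable.aestronglyMeasurable ?_
    refine Measurable.indicator ?_ (measurableSet_EvS _ _ _)
    refine (hgm.comp (measurable_pi_apply i0)).mul ?_
    refine Continuous.measurable ?_
    have := (quad_cont M).comp (scl_cont I u⁻¹)
    simp only [Function.comp_def] at this
    fun_prop
  · by_cases hy : y ∈ EvS I i0 (fun j => a j * u)
    · rw [Set.indicator_of_mem hy, Real.norm_eq_abs]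
      exact dom_bound M I i0 hi0 v hv0 lam hl hlow g hg _ y hy.1
    · rw [Set.indicator_of_notMem hy, norm_zero]
      exact Finset.prod_nonneg fun i _ => domF_nonneg _ _ _ _ _
  · have hmem : ∀ᶠ u : ℝ in atTop, (y ∈ EvS I i0 (fun j => a j * u) ↔ y ∈ EvL I Ns) := by
      have : ∀ j, ∀ᶠ u : ℝ in atTop, (j ∉ I → j ≠ i0 → a j * u < y j) ↔ (j ∈ Ns → 0 < y j) := by
        intro j
        by_cases h1 : j ∉ I ∧ j ≠ i0
        · rcases (ha j h1.1 h1.2).lt_or_eq with h | h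
          · have hn : j ∉ Ns := fun h' => h.ne ((hNs j).1 h').2.2
            filter_upwards [(tendsto_id.const_mul_atTop_of_neg h).eventually_lt_atBot (y j)] with u hu
            simp only [hn, false_imp_iff, iff_true]
            exact fun _ _ => hu
          · have hn : j ∈ Ns := (hNs j).2 ⟨h1.1, h1.2, h⟩
            simp [h, hn, h1.1, h1.2]
        · have hn : j ∉ Ns := fun h' => h1 ⟨((hNs j).1 h').1, ((hNs j).1 h').2.1⟩
          refine Eventually.of_forall fun u => ?_
          simp only [hn, false_imp_iff, iff_true]
          exact fun h h' => (h1 ⟨h, h'⟩).elim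
      filter_upwards [eventually_all.2 this] with u hu
      simp only [EvS, EvL, Set.mem_ofPred_eq]
      exact and_congr_right fun _ => forall_congr' hu
    have hlim : Tendsto (fun u : ℝ => g (y i0) * Real.exp (-(v ⬝ᵥ y) - (scl I u⁻¹ y ⬝ᵥ M.mulVec (scl I u⁻¹ y)) / 2))
        atTop (𝓝 (g (y i0) * Real.exp (-(v ⬝ᵥ y) - (scl I 0 y ⬝ᵥ M.mulVec (scl I 0 y)) / 2))) := by
      have hc : Continuous fun s : ℝ => g (y i0) * Real.exp (-(v ⬝ᵥ y) - (scl I s y ⬝ᵥ M.mulVec (scl I s y)) / 2) := by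
        have h1 : Continuous fun s : ℝ => scl I s y := by
          unfold scl
          refine continuous_pi fun i => ?_
          split_ifs <;> fun_prop
        have := (quad_cont M).comp h1
        simp only [Function.comp_def] at this
        fun_prop
      exact (hc.tendsto 0).comp tendsto_inv_atTop_zero
    by_cases hy : y ∈ EvL I Ns
    · rw [Set.indicator_of_mem hy]
      refine hlim.congr' ?_
      filter_upwards [hmem] with u hu
      rw [Set.indicator_of_mem (hu.2 hy)]
    · rw [Set.indicator_of_notMem hy]
      refine tendsto_const_nhds.congr' ?_
      filter_upwards [hmem] with u hu
      rw [Set.indicator_of_notMem (fun h => hy (hu.1 h))]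

lemma lim_pos {ι : Type*} [Fintype ι] [DecidableEq ι] (M : Matrix ι ι ℝ) (hM : M.PosDef)
    (I Ns : Finset ι)
    (i0 : ι) (hi0 : i0 ∉ I) (v : ι → ℝ) (hv : ∀ i ∈ I, 0 < v i) (hv0 : ∀ i, i ∉ I → v i = 0) :
    0 < ∫ y, (EvL I Ns).indicator (fun y : ι → ℝ => (1:ℝ) *
      Real.exp (-(v ⬝ᵥ y) - (scl I 0 y ⬝ᵥ M.mulVec (scl I 0 y)) / 2)) y := by
  obtain ⟨lam, hl, hlow⟩ := quad_lower M hM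
  have hmeas : Measurable ((EvL I Ns).indicator (fun y : ι → ℝ => (1:ℝ) *
      Real.exp (-(v ⬝ᵥ y) - (scl I 0 y ⬝ᵥ M.mulVec (scl I 0 y)) / 2))) := by
    refine Measurable.indicator ?_ (isOpen_EvL _ _).measurableSet
    refine Continuous.measurable ?_
    have := (quad_cont M).comp (scl_cont I 0)
    simp only [Function.comp_def] at this
    fun_prop
  rw [integral_pos_iff_support_of_nonneg]
  · refine lt_of_lt_of_le ((isOpen_EvL I Ns).measure_pos volume ⟨fun _ => 1, by simp [EvL]⟩) (measure_mono ?_)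
    intro y hy
    rw [Function.mem_support, Set.indicator_of_mem hy]
    positivity
  · intro y
    exact Set.indicator_nonneg (fun _ _ => by positivity) _
  · refine (dom_int I v hv _ (half_pos hl)).mono' hmeas.aestronglyMeasurable (Eventually.of_forall fun y => ?_)
    by_cases hy : y ∈ EvL I Ns
    · rw [Set.indicator_of_mem hy, Real.norm_eq_abs]
      exact dom_bound M I i0 hi0 v hv0 lam hl hlow (fun _ => 1) (by simp) _ y hy.1
    · rw [Set.indicator_of_notMem hy, norm_zero]
      exact Finset.prod_nonneg fun i _ => domF_nonneg _ _ _ _ _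

lemma cov_lemma {ι : Type*} [Fintype ι] [DecidableEq ι] (I : Finset ι) (s : ℝ) (hs : s ≠ 0) :
    ∃ C : ℝ, C ≠ 0 ∧ ∀ (F : (ι → ℝ) → ℝ) (b : ι → ℝ),
      ∫ x, F x = C * ∫ y, F (b + scl I s y) := by
  set D : Matrix ι ι ℝ := Matrix.diagonal fun i => if i ∈ I then s else 1 with hD
  have hdet : D.det ≠ 0 := by
    rw [hD, det_diagonal, Finset.prod_ne_zero_iff]
    intro i _; split_ifs <;> simp [hs]
  have hfun : (toLin' D : (ι → ℝ) → (ι → ℝ)) = scl I s := by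
    ext y i
    simp only [toLin'_apply, hD, mulVec_diagonal, scl]
    split_ifs <;> simp
  have hmap := Real.map_matrix_volume_pi_eq_smul_volume_pi hdet
  rw [hfun] at hmap
  have hinj : Function.Injective (scl I s) := by
    intro y z h
    ext i
    have := congrFun h i
    simp only [scl] at this
    split_ifs at this
    · exact mul_left_cancel₀ hs this
    · exact this
  have hemb : MeasurableEmbedding (scl I s) := (scl_cont I s).measurableEmbedding hinj
  refine ⟨|D.det|, abs_ne_zero.2 hdet, fun F b => ?_⟩
  have h1 : ∫ y, F (b + scl I s y) = ∫ x, F (b + x) ∂(Measure.map (scl I s) volume) :=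
    (hemb.integral_map fun x => F (b + x)).symm
  rw [h1, hmap, integral_smul_measure, integral_add_left_eq_self,
    ENNReal.toReal_ofReal (abs_nonneg _), abs_inv, smul_eq_mul, ← mul_assoc,
    mul_inv_cancel₀ (abs_ne_zero.2 hdet), one_mul]

lemma gaussPDF_cont {ι : Type*} [Fintype ι] [DecidableEq ι] (S : Matrix ι ι ℝ) :
    Continuous (gaussPDF S) := by
  unfold gaussPDF
  have := quad_cont S⁻¹
  fun_prop

lemma gaussPDF_nonneg {ι : Type*} [Fintype ι] [DecidableEq ι] (S : Matrix ι ι ℝ) (x : ι → ℝ) :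
    0 ≤ gaussPDF S x := by
  unfold gaussPDF
  positivity

lemma integral_gauss {ι : Type*} [Fintype ι] [DecidableEq ι] (S : Matrix ι ι ℝ) (F : (ι → ℝ) → ℝ) :
    ∫ x, F x ∂((volume : Measure (ι → ℝ)).withDensity fun x => ENNReal.ofReal (gaussPDF S x)) =
    ∫ x, gaussPDF S x * F x := by
  rw [integral_withDensity_eq_integral_toReal_smul]
  · refine integral_congr_ae (Eventually.of_forall fun x => ?_)
    simp [ENNReal.toReal_ofReal (gaussPDF_nonneg S x)]
  · exact (gaussPDF_cont S).measurable.ennreal_ofReal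
  · exact Eventually.of_forall fun x => ENNReal.ofReal_lt_top

lemma quad_expand {ι : Type*} [Fintype ι] [DecidableEq ι] (M : Matrix ι ι ℝ) (hM : M.PosDef)
    (I : Finset ι) (v xs : ι → ℝ) (hv0 : ∀ i, i ∉ I → v i = 0) (hxs : M.mulVec xs = v)
    (u : ℝ) (hu : u ≠ 0) (y : ι → ℝ) :
    (u • xs + scl I u⁻¹ y) ⬝ᵥ M.mulVec (u • xs + scl I u⁻¹ y) =
      u ^ 2 * (xs ⬝ᵥ v) + 2 * (v ⬝ᵥ y) + scl I u⁻¹ y ⬝ᵥ M.mulVec (scl I u⁻¹ y) := by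
  have hsym : Mᵀ = M := by
    ext i j
    simpa using hM.1.apply i j
  have h1 : u * (v ⬝ᵥ scl I u⁻¹ y) = v ⬝ᵥ y := by
    simp only [dotProduct, Finset.mul_sum, scl]
    refine Finset.sum_congr rfl fun i _ => ?_
    by_cases hi : i ∈ I
    · simp only [hi, if_true]; field_simp
    · simp [hi, hv0 i hi]
  have h2 : xs ⬝ᵥ M.mulVec (scl I u⁻¹ y) = v ⬝ᵥ scl I u⁻¹ y := by
    rw [dotProduct_mulVec, ← mulVec_transpose, hsym, hxs]
  have h3 : scl I u⁻¹ y ⬝ᵥ v = v ⬝ᵥ scl I u⁻¹ y := dotProduct_comm _ _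
  simp only [mulVec_add, mulVec_smul, hxs, add_dotProduct, dotProduct_add, smul_dotProduct,
    dotProduct_smul, smul_eq_mul, h2, h3]
  rw [← h1]; ring

lemma tail_integral {Ω ι : Type*} [MeasurableSpace Ω] [Fintype ι] [DecidableEq ι] (P : Measure Ω)
    (A : Matrix ι ι ℝ) (hA : A.PosDef) (X : Ω → ι → ℝ) (hX : Measurable X)
    (hG : IsCenteredGaussianRV P X A) (c : ι → ℝ) (I : Finset ι) (i0 : ι) (hi0 : i0 ∉ I)
    (v xs : ι → ℝ) (hv0 : ∀ i, i ∉ I → v i = 0) (hxs : A⁻¹.mulVec xs = v)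
    (hxI : ∀ i ∈ I, xs i = c i) (hx0 : xs i0 = c i0) (u : ℝ) (hu : 0 < u) :
    ∃ C : ℝ, C ≠ 0 ∧ ∀ g : ℝ → ℝ, Measurable g →
      ∫ ω in {ω | ∀ i, i ≠ i0 → c i * u < X ω i}, g (X ω i0 - c i0 * u) ∂P =
      C * ∫ y, (EvS I i0 (fun j => (c j - xs j) * u)).indicator (fun y => g (y i0) *
      Real.exp (-(v ⬝ᵥ y) - (scl I u⁻¹ y ⬝ᵥ A⁻¹.mulVec (scl I u⁻¹ y)) / 2)) y := by
  obtain ⟨C, hC, hcov⟩ := cov_lemma I u⁻¹ (inv_ne_zero hu.ne')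
  set K := (Real.sqrt ((2 * Real.pi) ^ Fintype.card ι * A.det))⁻¹ with hK
  have hKpos : K ≠ 0 := by
    have := hA.det_pos
    positivity
  refine ⟨C * (K * Real.exp (-(u ^ 2 * (xs ⬝ᵥ v)) / 2)), by positivity, fun g hg => ?_⟩
  set T : Set (ι → ℝ) := {x | ∀ i, i ≠ i0 → c i * u < x i} with hT
  have hTm : MeasurableSet T := by
    rw [hT]
    simp only [measurableSet_setOfPred]
    fun_prop
  have hTp : {ω | ∀ i, i ≠ i0 → c i * u < X ω i} = X ⁻¹' T := rfl
  rw [hTp, ← integral_indicator (hX hTm)]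
  have e1 : ∫ ω, (X ⁻¹' T).indicator (fun ω => g (X ω i0 - c i0 * u)) ω ∂P
      = ∫ x, T.indicator (fun x => g (x i0 - c i0 * u)) x ∂(Measure.map X P) := by
    rw [integral_map hX.aemeasurable]
    · rfl
    · refine (Measurable.indicator ?_ hTm).aestronglyMeasurable
      fun_prop
  rw [e1, show Measure.map X P = _ from hG, integral_gauss, hcov _ (u • xs), mul_assoc]
  congr 1
  rw [← integral_const_mul]
  refine integral_congr_ae (Eventually.of_forall fun y => ?_)
  have hmem : (u • xs + scl I u⁻¹ y) ∈ T ↔ y ∈ EvS I i0 (fun j => (c j - xs j) * u) := by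
    simp only [hT, EvS, Set.mem_ofPred_eq, Pi.add_apply, Pi.smul_apply, smul_eq_mul, scl]
    constructor
    · intro h
      refine ⟨fun i hi => ?_, fun j hj hj0 => ?_⟩
      · have := h i (fun h' => hi0 (h' ▸ hi))
        rw [if_pos hi, hxI i hi] at this
        have h2 : 0 < u⁻¹ * y i := by linarith
        exact (pos_iff_pos_of_mul_pos h2).1 (inv_pos.2 hu)
      · have := h j hj0
        rw [if_neg hj] at this
        linarith
    · rintro ⟨h1, h2⟩ i hi0
      by_cases hi : i ∈ I
      · rw [if_pos hi, hxI i hi]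
        have : 0 < u⁻¹ * y i := mul_pos (inv_pos.2 hu) (h1 i hi)
        linarith
      · rw [if_neg hi]
        have := h2 i hi hi0
        linarith
  by_cases hy : y ∈ EvS I i0 (fun j => (c j - xs j) * u)
  · simp only [Set.indicator_of_mem hy, Set.indicator_of_mem (hmem.2 hy)]
    have h0 : (u • xs + scl I u⁻¹ y) i0 - c i0 * u = y i0 := by
      simp [scl, hi0, hx0]; ring
    rw [h0]
    unfold gaussPDF
    rw [quad_expand A⁻¹ hA.inv I v xs hv0 hxs u hu.ne' y]
    have : Real.exp (-(u ^ 2 * (xs ⬝ᵥ v) + 2 * (v ⬝ᵥ y) + scl I u⁻¹ y ⬝ᵥ A⁻¹.mulVec (scl I u⁻¹ y)) / 2)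
      = Real.exp (-(u ^ 2 * (xs ⬝ᵥ v)) / 2) * Real.exp (-(v ⬝ᵥ y) - (scl I u⁻¹ y ⬝ᵥ A⁻¹.mulVec (scl I u⁻¹ y)) / 2) := by
      rw [← Real.exp_add]; congr 1; ring
    rw [this, ← hK]
    ring
  · simp only [Set.indicator_of_notMem hy, Set.indicator_of_notMem (fun h => hy (hmem.1 h)), mul_zero]

lemma schur_mul {ι : Type*} [Fintype ι] [DecidableEq ι] (A : Matrix ι ι ℝ) (hA : A.PosDef)
    (I : Finset ι) : schurC A I * subM A⁻¹ Iᶜ Iᶜ = 1 := by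
  have hdetI : IsUnit (subM A I I).det := by
    have : (subM A I I).PosDef := hA.submatrix (e := fun i : ↥I => (i : ι)) Subtype.val_injective
    exact this.det_pos.ne'.isUnit
  have hAM : A * A⁻¹ = 1 := mul_nonsing_inv _ hA.det_pos.ne'.isUnit
  have hsum : ∀ f : ι → ℝ, ∑ i, f i = ∑ i : ↥I, f i + ∑ i : ↥Iᶜ, f i := by
    intro f
    rw [Finset.sum_coe_sort I f, Finset.sum_coe_sort Iᶜ f, Finset.sum_add_sum_compl]
  have h1 : subM A I I * subM A⁻¹ I Iᶜ + subM A I Iᶜ * subM A⁻¹ Iᶜ Iᶜ = 0 := by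
    ext i j
    have := congrFun (congrFun hAM i) j
    rw [mul_apply, hsum] at this
    simp only [Matrix.add_apply, mul_apply, subM, Matrix.zero_apply]
    rw [this, one_apply_ne]
    intro h
    exact (Finset.mem_compl.1 j.2) (h ▸ i.2)
  have h2 : subM A Iᶜ I * subM A⁻¹ I Iᶜ + subM A Iᶜ Iᶜ * subM A⁻¹ Iᶜ Iᶜ = 1 := by
    ext i j
    have := congrFun (congrFun hAM i) j
    rw [mul_apply, hsum] at this
    simp only [Matrix.add_apply, mul_apply, subM]
    rw [this, one_apply, one_apply]
    by_cases hij : i = j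
    · rw [if_pos hij, if_pos (congrArg Subtype.val hij)]
    · rw [if_neg hij, if_neg (fun h => hij (Subtype.ext h))]
  have h3 : subM A⁻¹ I Iᶜ = - ((subM A I I)⁻¹ * (subM A I Iᶜ * subM A⁻¹ Iᶜ Iᶜ)) := by
    have h4 : subM A I I * subM A⁻¹ I Iᶜ = - (subM A I Iᶜ * subM A⁻¹ Iᶜ Iᶜ) := eq_neg_of_add_eq_zero_left h1
    rw [← Matrix.mul_neg, ← h4, nonsing_inv_mul_cancel_left _ _ hdetI]
  rw [schurC, Matrix.sub_mul, ← h2, h3]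
  simp only [Matrix.mul_assoc, Matrix.mul_neg]
  abel

lemma split_integral {ι : Type*} [Fintype ι] [DecidableEq ι] (A : Matrix ι ι ℝ) (hA : A.PosDef)
    (I Ns : Finset ι) (hN : ∀ j ∈ Ns, j ∉ I) (i0 : ι) (hi0 : i0 ∈ Iᶜ) (v : ι → ℝ)
    (hv0 : ∀ i, i ∉ I → v i = 0) :
    ∃ C : ℝ, ∀ g : ℝ → ℝ, ∫ y, (EvL I Ns).indicator (fun y => g (y i0) *
      Real.exp (-(v ⬝ᵥ y) - (scl I 0 y ⬝ᵥ A⁻¹.mulVec (scl I 0 y)) / 2)) y =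
      C * ∫ z in {y : ↥Iᶜ → ℝ | ∀ j : ↥Iᶜ, (j : ι) ∈ Ns → 0 < y j}, g (z ⟨i0, hi0⟩) ∂(condNu A I) := by
  have hsm := schur_mul A hA I
  have hinv : (schurC A I)⁻¹ = subM A⁻¹ Iᶜ Iᶜ := inv_eq_right_inv hsm
  have hdet : 0 < (schurC A I).det := by
    have h1 : (subM A⁻¹ Iᶜ Iᶜ).PosDef := hA.inv.submatrix (e := fun i : ↥Iᶜ => (i : ι)) Subtype.val_injective
    have h2 := congrArg Matrix.det hsm
    rw [det_mul, det_one] at h2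
    exact (pos_iff_pos_of_mul_pos (by rw [h2]; exact one_pos)).2 h1.det_pos
  set K := (Real.sqrt ((2 * Real.pi) ^ Fintype.card ↥Iᶜ * (schurC A I).det))⁻¹ with hK
  have hKpos : K ≠ 0 := by positivity
  set T : Set (↥Iᶜ → ℝ) := {y : ↥Iᶜ → ℝ | ∀ j : ↥Iᶜ, (j : ι) ∈ Ns → 0 < y j} with hT
  have hTm : MeasurableSet T := by
    rw [hT]
    simp only [measurableSet_setOfPred]
    fun_prop
  set T2 : Set ({i // ¬ i ∈ Iᶜ} → ℝ) := {z | ∀ i, 0 < z i} with hT2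
  refine ⟨(∫ z : {i // ¬ i ∈ Iᶜ} → ℝ, T2.indicator (fun z => Real.exp (-∑ i : {i // ¬ i ∈ Iᶜ}, v i * z i)) z) * K⁻¹, fun g => ?_⟩
  rw [← integral_indicator hTm, condNu, integral_gauss]
  have hmp := volume_preserving_piEquivPiSubtypeProd (fun _ : ι => ℝ) (fun i => i ∈ Iᶜ)
  have e1 : ∫ z, gaussPDF (schurC A I) z * T.indicator (fun z => g (z ⟨i0, hi0⟩)) z =
      K * ∫ z, T.indicator (fun z => g (z ⟨i0, hi0⟩) * Real.exp (-(z ⬝ᵥ (subM A⁻¹ Iᶜ Iᶜ).mulVec z) / 2)) z := by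
    rw [← integral_const_mul]
    refine integral_congr_ae (Eventually.of_forall fun z => ?_)
    by_cases hz : z ∈ T
    · simp only [Set.indicator_of_mem hz]
      rw [gaussPDF, hinv, ← hK]; ring
    · simp only [Set.indicator_of_notMem hz, mul_zero]
  rw [e1, mul_assoc, inv_mul_cancel_left₀ hKpos, mul_comm, ← integral_prod_mul]
  have hmp' := hmp.integral_comp (MeasurableEquiv.measurableEmbedding _)
    (fun p : (↥Iᶜ → ℝ) × ({i // ¬ i ∈ Iᶜ} → ℝ) => T.indicator (fun z => g (z ⟨i0, hi0⟩) * Real.exp (-(z ⬝ᵥ (subM A⁻¹ Iᶜ Iᶜ).mulVec z) / 2)) p.1 *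
      T2.indicator (fun z => Real.exp (-∑ i : {i // ¬ i ∈ Iᶜ}, v i * z i)) p.2)
  refine Eq.trans ?_ (hmp'.trans ?_)
  swap
  · rw [Measure.volume_eq_prod]
    congr!
  refine integral_congr_ae (Eventually.of_forall fun y => ?_)
  set z : ↥Iᶜ → ℝ := fun i => y i with hz
  set w : {i // ¬ i ∈ Iᶜ} → ℝ := fun i => y i with hw
  change _ = T.indicator _ z * T2.indicator _ w
  have hmem : y ∈ EvL I Ns ↔ z ∈ T ∧ w ∈ T2 := by
    simp only [EvL, hT, hT2, Set.mem_ofPred_eq, hz, hw]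
    constructor
    · rintro ⟨h1, h2⟩
      exact ⟨fun j hj => h2 j hj, fun i => h1 i (by simpa using i.2)⟩
    · rintro ⟨h1, h2⟩
      exact ⟨fun i hi => h2 ⟨i, by simpa using hi⟩, fun j hj => h1 ⟨j, by simpa using hN j hj⟩ hj⟩
  have hq : scl I 0 y ⬝ᵥ A⁻¹.mulVec (scl I 0 y) = z ⬝ᵥ (subM A⁻¹ Iᶜ Iᶜ).mulVec z := by
    have hs : ∀ f : ι → ℝ, ∑ i, scl I 0 y i * f i = ∑ i : ↥Iᶜ, z i * f i := by
      intro f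
      rw [hz, Finset.sum_coe_sort Iᶜ (fun i => y i * f i), ← Finset.sum_add_sum_compl I]
      rw [Finset.sum_eq_zero, zero_add]
      · refine Finset.sum_congr rfl fun i hi => ?_
        simp [scl, Finset.mem_compl.1 hi]
      · intro i hi; simp [scl, hi]
    simp only [dotProduct, mulVec]
    rw [hs]
    refine Finset.sum_congr rfl fun i _ => ?_
    congr 1
    simp only [mul_comm _ (scl I 0 y _)]
    rw [hs]
    refine Finset.sum_congr rfl fun j _ => ?_
    simp only [subM]; ring
  have hvy : v ⬝ᵥ y = ∑ i : {i // ¬ i ∈ Iᶜ}, v i * w i := by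
    simp only [dotProduct, hw]
    rw [← Fintype.sum_subtype_add_sum_subtype (fun i => i ∈ Iᶜ) (fun i => v i * y i)]
    rw [Finset.sum_eq_zero, zero_add]
    intro i _
    rw [hv0 i (Finset.mem_compl.1 i.2), zero_mul]
  by_cases hy : y ∈ EvL I Ns
  · obtain ⟨h1, h2⟩ := hmem.1 hy
    rw [Set.indicator_of_mem hy, Set.indicator_of_mem h1, Set.indicator_of_mem h2, hq, hvy,
      mul_assoc, ← Real.exp_add]
    congr 2
    ring
  · rw [Set.indicator_of_notMem hy]
    rw [hmem, not_and_or] at hy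
    rcases hy with h | h
    · rw [Set.indicator_of_notMem h, zero_mul]
    · rw [Set.indicator_of_notMem h, mul_zero]

lemma integrable_coord {Ω ι : Type*} [MeasurableSpace Ω] [Fintype ι] [DecidableEq ι] (P : Measure Ω)
    (A : Matrix ι ι ℝ) (hA : A.PosDef) (X : Ω → ι → ℝ) (hX : Measurable X)
    (hG : IsCenteredGaussianRV P X A) (i0 : ι) : Integrable (fun ω => X ω i0) P := by
  have h1 : Integrable (fun x : ι → ℝ => x i0) (Measure.map X P) := by
    rw [show Measure.map X P = _ from hG, integrable_withDensity_iff_integrable_smul'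
      (gaussPDF_cont A).measurable.ennreal_ofReal (Eventually.of_forall fun x => ENNReal.ofReal_lt_top)]
    obtain ⟨lam, hl, hlow⟩ := quad_lower A⁻¹ hA.inv
    have hd := (dom_int (∅ : Finset ι) 0 (by simp) _ (half_pos hl)).const_mul
      ((Real.sqrt ((2 * Real.pi) ^ Fintype.card ι * A.det))⁻¹)
    refine hd.mono' ?_ (Eventually.of_forall fun y => ?_)
    · refine Measurable.aestronglyMeasurable ?_
      have := (gaussPDF_cont A).measurable
      fun_prop
    · have hb := dom_bound A⁻¹ ∅ i0 (by simp) 0 (by simp) lam hl hlow (fun t => t) (fun t => by linarith) 1 y (by simp)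
      have hs : scl ∅ 1 y = y := by ext i; simp [scl]
      rw [hs, zero_dotProduct] at hb
      rw [ENNReal.toReal_ofReal (gaussPDF_nonneg A y), smul_eq_mul, Real.norm_eq_abs, gaussPDF,
        mul_assoc, abs_mul, abs_of_nonneg (a := (Real.sqrt _)⁻¹) (by positivity)]
      gcongr
      refine le_trans (le_of_eq ?_) hb
      rw [mul_comm]
      congr 3
      ring
  exact h1.comp_measurable hX

lemma core {Ω ι : Type*} [MeasurableSpace Ω] [Fintype ι] [DecidableEq ι] (P : Measure Ω)
    [IsProbabilityMeasure P]
    (A : Matrix ι ι ℝ) (hA : A.PosDef) (X : Ω → ι → ℝ) (hX : Measurable X)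
    (hG : IsCenteredGaussianRV P X A) (c : ι → ℝ) (I Ns : Finset ι) (i0 : ι) (hi0 : i0 ∉ I)
    (v xs : ι → ℝ) (hv : ∀ i ∈ I, 0 < v i) (hv0 : ∀ i, i ∉ I → v i = 0) (hxs : A⁻¹.mulVec xs = v)
    (hxI : ∀ i ∈ I, xs i = c i) (hx0 : xs i0 = c i0)
    (hle : ∀ j, j ∉ I → j ≠ i0 → c j ≤ xs j)
    (hNs : ∀ j, j ∈ Ns ↔ j ∉ I ∧ j ≠ i0 ∧ xs j = c j) :
    Tendsto (fun u : ℝ => (∫ ω in {ω | ∀ i, i ≠ i0 → c i * u < X ω i}, X ω i0 ∂P) /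
        (P {ω | ∀ i, i ≠ i0 → c i * u < X ω i}).toReal - c i0 * u) atTop
      (𝓝 (condMean A I Ns i0)) := by
  have hi0' : i0 ∈ Iᶜ := Finset.mem_compl.2 hi0
  have hT := fun g hgm hg => main_tendsto A⁻¹ hA.inv I Ns i0 hi0 v hv hv0 (fun j => c j - xs j)
    (fun j h1 h2 => by linarith [hle j h1 h2])
    (fun j => by rw [hNs j, sub_eq_zero, eq_comm (a := c j)]) g hgm hg
  obtain ⟨C, hC⟩ := split_integral A hA I Ns (fun j hj => ((hNs j).1 hj).1) i0 hi0' v hv0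
  have hpos := lim_pos A⁻¹ hA.inv I Ns i0 hi0 v hv hv0
  have hnum := hT (fun t => t) measurable_id (fun t => by linarith)
  have hden := hT (fun _ => 1) measurable_const (fun t => by simp)
  have hC1 := hC (fun _ => 1)
  have hlim := hnum.div hden hpos.ne'
  rw [hC1] at hpos
  have hC0 : C ≠ 0 := by rintro rfl; simp at hpos
  rw [hC1, hC (fun t => t), mul_div_mul_left _ _ hC0] at hlim
  have hcm : condMean A I Ns i0 = (∫ z in {y : ↥Iᶜ → ℝ | ∀ j : ↥Iᶜ, (j : ι) ∈ Ns → 0 < y j}, (z ⟨i0, hi0'⟩) ∂(condNu A I)) / (∫ z in {y : ↥Iᶜ → ℝ | ∀ j : ↥Iᶜ, (j : ι) ∈ Ns → 0 < y j}, (1:ℝ) ∂(condNu A I)) := by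
    unfold condMean
    congr 1
    · congr 1
      ext y
      rw [Finset.sum_eq_single (⟨i0, hi0'⟩ : ↥Iᶜ)]
      · simp
      · intro j _ hj
        rw [if_neg (fun h => hj (Subtype.ext h))]
      · simp
    · simp [Measure.real]
  rw [hcm]
  refine hlim.congr' ?_
  filter_upwards [eventually_gt_atTop 0, hden.eventually_ne (by rw [hC1]; exact hpos.ne')] with u hu hne
  obtain ⟨C', hC', hti⟩ := tail_integral P A hA X hX hG c I i0 hi0 v xs hv0 hxs hxI hx0 u hu
  set T := {ω | ∀ i, i ≠ i0 → c i * u < X ω i} with hTdef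
  have h1 := hti (fun t => t) measurable_id
  have h2 := hti (fun _ => 1) measurable_const
  have h3 : ∫ ω in T, (1:ℝ) ∂P = (P T).toReal := by simp [Measure.real]
  have h4 : ∫ ω in T, (X ω i0 - c i0 * u) ∂P = ∫ ω in T, X ω i0 ∂P - c i0 * u * (P T).toReal := by
    rw [integral_sub (integrable_coord P A hA X hX hG i0).integrableOn (integrable_const _)]
    simp [Measure.real, mul_comm]
  simp only [Pi.div_apply]
  rw [h3] at h2
  rw [h4] at h1
  have hP : (P T).toReal ≠ 0 := by rw [h2]; exact mul_ne_zero hC' hne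
  rw [← mul_div_mul_left _ _ hC', ← h1, ← h2]
  field_simp

/-- Theorem 2.2: with `𝓘, 𝓛` the index sets of `Π_B(c_{-1})`, `B` the covariance matrix of
`X_{-1}`, `𝓘 = {k,...,d-1}`, `I = {k+1,...,d}` and `c_1 = Σ_{1,I}(Σ_II)⁻¹c_I`, one has
`S(c,u) - c_1 u → E[Y]` as `u → ∞`, where `Y` is the distributional limit of `X_1 - c_1 u`
given `X_{-1} > c_{-1} u`, with survival function `Gbar A I N* 1`, `N* = 𝓛 \ 𝓘`
(in the labels of `X`). -/
theorem mes_multivariate_gaussian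
    {Ω : Type*} [MeasurableSpace Ω] (P : Measure Ω) [IsProbabilityMeasure P]
    {d : ℕ} [NeZero d] (A : Matrix (Fin d) (Fin d) ℝ) (hA : A.PosDef)
    (hcorr : ∀ i, A i i = 1)
    (X : Ω → Fin d → ℝ) (hX : Measurable X) (hG : IsCenteredGaussianRV P X A)
    (c : Fin d → ℝ) (hb : ∃ i : ↥(offFirst d), 0 < c (i : Fin d))
    (btT : ↥(offFirst d) → ℝ) (calI calL : Finset ↥(offFirst d))
    (hsolB : IsQPSol (subM A (offFirst d) (offFirst d)) (subV c (offFirst d)) btT)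
    (hIB : IsQPIndex (subM A (offFirst d) (offFirst d)) (subV c (offFirst d)) btT calI)
    (hLB : ∀ i, i ∈ calL ↔ btT i = c (i : Fin d))
    (k : ℕ) (hk1 : 1 ≤ k) (hkd : k < d)
    (hIm : calI.image Subtype.val = Finset.univ.filter fun i : Fin d => k ≤ (i : ℕ))
    (hc1 : c 0 = rowDot A c (calI.image Subtype.val) 0) :
    Tendsto (fun u => mesV P X c u - c 0 * u) atTop
      (𝓝 (condMean A (calI.image Subtype.val) ((calL \ calI).image Subtype.val) 0)) := by
  set I := calI.image Subtype.val with hI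
  have h0off : ∀ i : ↥(offFirst d), (i : Fin d) ≠ 0 := fun i => by
    have := i.2
    simpa [offFirst] using this
  have hoff : ∀ i : Fin d, i ≠ 0 → i ∈ offFirst d := fun i hi => by simpa [offFirst] using hi
  have hmemI : ∀ i : ↥(offFirst d), (i : Fin d) ∈ I ↔ i ∈ calI := by
    intro i
    rw [hI]
    simp
  have hi0 : (0 : Fin d) ∉ I := by
    rw [hI]
    intro h
    obtain ⟨j, _, hj⟩ := Finset.mem_image.1 h
    exact h0off j hj
  -- equivalence
  let e : ↥calI ≃ ↥I := Equiv.ofBijective (fun i => ⟨(i : ↥(offFirst d)), (hmemI _).2 i.2⟩) (by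
    constructor
    · intro a b h
      exact Subtype.ext (Subtype.ext (congrArg (fun x : ↥I => (x : Fin d)) h))
    · rintro ⟨i, hi⟩
      obtain ⟨j, hj, rfl⟩ := Finset.mem_image.1 hi
      exact ⟨⟨j, hj⟩, rfl⟩)
  have he : ∀ i, ((e i : ↥I) : Fin d) = ((i : ↥(offFirst d)) : Fin d) := fun i => rfl
  set w : ↥I → ℝ := (subM A I I)⁻¹.mulVec (subV c I) with hw
  have hsub : subM (subM A (offFirst d) (offFirst d)) calI calI = (subM A I I).submatrix e e := by
    ext i j; rfl
  have hwe : (subM (subM A (offFirst d) (offFirst d)) calI calI)⁻¹.mulVec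
      (subV (subV c (offFirst d)) calI) = w ∘ e := by
    have h1 : subV (subV c (offFirst d)) calI = subV c I ∘ e := rfl
    rw [hsub, inv_submatrix_equiv, h1, submatrix_mulVec_equiv]
    simp [Function.comp_def, hw]
  obtain ⟨_, hbI, hwpos, hbJ⟩ := hIB
  rw [hwe] at hwpos hbJ
  have hdetI : IsUnit (subM A I I).det := by
    have : (subM A I I).PosDef := hA.submatrix (e := fun i : ↥I => (i : Fin d)) Subtype.val_injective
    exact this.det_pos.ne'.isUnit
  set v : Fin d → ℝ := fun i => if h : i ∈ I then w ⟨i, h⟩ else 0 with hv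
  have hAv : ∀ j, (A.mulVec v) j = (fun i : ↥I => A j i) ⬝ᵥ w := by
    intro j
    simp only [mulVec, dotProduct]
    rw [← Finset.sum_add_sum_compl I, ← Finset.sum_coe_sort I, Finset.sum_eq_zero (s := Iᶜ), add_zero]
    · refine Finset.sum_congr rfl fun i _ => ?_
      simp [hv]
    · intro i hi
      simp [hv, Finset.mem_compl.1 hi]
  have hxJ : ∀ j : ↥(offFirst d), j ∉ calI → (A.mulVec v) j = btT j := by
    intro j hj
    rw [hAv, hbJ j hj]
    simp only [dotProduct]
    rw [← Equiv.sum_comp e]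
    rfl
  refine core P A hA X hX hG c I _ 0 hi0 v (A.mulVec v) ?_ ?_ ?_ ?_ ?_ ?_ ?_
  · intro i hi
    have := hwpos (e.symm ⟨i, hi⟩)
    simpa [hv, hi] using this
  · intro i hi
    simp [hv, hi]
  · rw [mulVec_mulVec, nonsing_inv_mul _ hA.det_pos.ne'.isUnit, one_mulVec]
  · intro i hi
    rw [hAv]
    have : (subM A I I).mulVec w = subV c I := by
      rw [hw, mulVec_mulVec, mul_nonsing_inv _ hdetI, one_mulVec]
    exact congrFun this ⟨i, hi⟩
  · rw [hAv, hc1]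
    rfl
  · intro j hj hj0
    have := hxJ ⟨j, hoff j hj0⟩ (fun h => hj ((hmemI _).2 h))
    simp only at this
    rw [this]
    exact hsolB.1 ⟨j, hoff j hj0⟩
  · intro j
    rw [Finset.mem_image]
    constructor
    · rintro ⟨i, hi, rfl⟩
      rw [Finset.mem_sdiff] at hi
      refine ⟨fun h => hi.2 ((hmemI _).1 h), h0off i, ?_⟩
      rw [hxJ i hi.2]
      exact (hLB i).1 hi.1
    · rintro ⟨h1, h2, h3⟩
      have h4 : (⟨j, hoff j h2⟩ : ↥(offFirst d)) ∉ calI := fun h => h1 ((hmemI _).2 h)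
      refine ⟨⟨j, hoff j h2⟩, Finset.mem_sdiff.2 ⟨(hLB _).2 ?_, h4⟩, rfl⟩
      rw [← hxJ _ h4]
      exact h3
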